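/- Let n ≥ 5 and r ≥ 2 be integers. Then the maximum of |E(G)| over all finite simple graphs G of order n with CR(G) = 2 and γ_CR(G) = r equals: C(n−1, 2) + 1 if r = 2; 2(r − 2) + C(n−r+1, 2) + 1 if 3 ≤ r ≤ n − 4 and n − r − 2 ≥ r; 2(r − 2) + C(n−r+1, 2) if 3 ≤ r ≤ n − 4 and n − r − 2 < r; 7 if r = n − 3; and 4 if r = n − 2. -/

import Mathlib

open SimpleGraph Set

/-- The closed neighborhood `N[v]` of a vertex `v`. -/
def closedNbhd {V : Type*} (G : SimpleGraph V) (v : V) : Set V :=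
  insert v (G.neighborSet v)

/-- `S` is a dominating set of `G`: every vertex lies in `N[s]` for some `s ∈ S`. -/
def IsDomSet {V : Type*} (G : SimpleGraph V) (S : Set V) : Prop :=
  ∀ v : V, ∃ s ∈ S, v ∈ closedNbhd G s

/-- `CR(S)`: the number of vertices overdominated by `S`, i.e. with `|N[x] ∩ S| ≥ 2`. -/
noncomputable def crOf {V : Type*} (G : SimpleGraph V) (S : Set V) : ℕ :=
  {x : V | 2 ≤ (closedNbhd G x ∩ S).ncard}.ncard

/-- `CR(G)`: the minimum of `CR(S)` over all dominating sets `S` of `G`. -/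
noncomputable def crNum {V : Type*} (G : SimpleGraph V) : ℕ :=
  sInf {k : ℕ | ∃ S : Set V, IsDomSet G S ∧ crOf G S = k}

/-- `γ_CR(G)`: the minimum cardinality of a dominating set `S` with `CR(S) = CR(G)`. -/
noncomputable def gammaCR {V : Type*} (G : SimpleGraph V) : ℕ :=
  sInf {r : ℕ | ∃ S : Set V, IsDomSet G S ∧ crOf G S = crNum G ∧ S.ncard = r}

/-- `IsMaxEdges n r M` : among all graphs of order `n` with `CR(G) = 2` and
`γ_CR(G) = r`, the maximum number of edges is `M`. -/
def IsMaxEdges (n r M : ℕ) : Prop :=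
  (∀ (V : Type) [Fintype V] (G : SimpleGraph V), Fintype.card V = n →
      crNum G = 2 → gammaCR G = r → G.edgeSet.ncard ≤ M) ∧
  (∃ G : SimpleGraph (Fin n), crNum G = 2 ∧ gammaCR G = r ∧ G.edgeSet.ncard = M)

section Basic

variable {V : Type*} {G : SimpleGraph V}

theorem mem_closedNbhd {v w : V} : w ∈ closedNbhd G v ↔ w = v ∨ G.Adj v w := by
  simp [closedNbhd]

theorem two_le_ncard_closedNbhd_inter [Finite V] {S : Set V} {v : V} :
    2 ≤ (closedNbhd G v ∩ S).ncard ↔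
      ∃ s ∈ S, ∃ t ∈ S, s ≠ t ∧ (s = v ∨ G.Adj v s) ∧ (t = v ∨ G.Adj v t) := by
  rw [Nat.succ_le_iff, Set.one_lt_ncard]
  simp only [Set.mem_inter_iff, mem_closedNbhd]
  constructor
  · rintro ⟨s, hs, t, ht, hne⟩
    exact ⟨s, hs.2, t, ht.2, hne, hs.1, ht.1⟩
  · rintro ⟨s, hs, t, ht, hne, hs', ht'⟩
    exact ⟨s, ⟨hs', hs⟩, t, ⟨ht', ht⟩, hne⟩

theorem isDomSet_iff {S : Set V} : IsDomSet G S ↔ ∀ v, ∃ s ∈ S, s = v ∨ G.Adj v s := by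
  simp only [IsDomSet, mem_closedNbhd, eq_comm, G.adj_comm]

theorem crNum_le {S : Set V} (hS : IsDomSet G S) : crNum G ≤ crOf G S :=
  Nat.sInf_le ⟨S, hS, rfl⟩

theorem gammaCR_le {S : Set V} (hS : IsDomSet G S) (h : crOf G S = crNum G) :
    gammaCR G ≤ S.ncard :=
  Nat.sInf_le ⟨S, hS, h, rfl⟩

theorem crOf_le_two [Finite V] {S : Set V} (u v : V)
    (h : ∀ w, w ≠ u → w ≠ v → ∀ s ∈ S, ∀ t ∈ S,
      (s = w ∨ G.Adj w s) → (t = w ∨ G.Adj w t) → s = t) : crOf G S ≤ 2 := by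
  refine (Set.ncard_le_ncard (t := {u, v}) ?_ (Set.toFinite _)).trans
    ((Set.ncard_insert_le u {v}).trans (by simp))
  intro w hw
  obtain ⟨s, hs, t, ht, hne, h1, h2⟩ := two_le_ncard_closedNbhd_inter.1 hw
  by_contra hc
  simp only [Set.mem_insert_iff, Set.mem_singleton_iff, not_or] at hc
  exact hne (h w hc.1 hc.2 s hs t ht h1 h2)

/-- A dominating set overdominating at most two vertices is no smaller than a `γ_CR`-set,
when `CR(G) = 2`. -/
theorem gammaCR_le_of_overdominated [Finite V] (hcr : crNum G = 2) {D : Set V} (u v : V)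
    (hD : ∀ w, ∃ s ∈ D, s = w ∨ G.Adj w s)
    (h : ∀ w, w ≠ u → w ≠ v → ∀ s ∈ D, ∀ t ∈ D,
      (s = w ∨ G.Adj w s) → (t = w ∨ G.Adj w t) → s = t) : gammaCR G ≤ D.ncard := by
  have hdom := isDomSet_iff.2 hD
  have h1 := crNum_le hdom
  have h2 := crOf_le_two u v h
  exact gammaCR_le hdom (by omega)

theorem two_le_crOf [Finite V] {D : Set V} {u v : V} (huv : u ≠ v)
    (hu : ∃ s ∈ D, ∃ t ∈ D, s ≠ t ∧ (s = u ∨ G.Adj u s) ∧ (t = u ∨ G.Adj u t))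
    (hv : ∃ s ∈ D, ∃ t ∈ D, s ≠ t ∧ (s = v ∨ G.Adj v s) ∧ (t = v ∨ G.Adj v t)) :
    2 ≤ crOf G D := by
  rw [← Set.ncard_pair huv]
  refine Set.ncard_le_ncard ?_ (Set.toFinite _)
  rintro w (rfl | rfl)
  · exact two_le_ncard_closedNbhd_inter.2 hu
  · exact two_le_ncard_closedNbhd_inter.2 hv

theorem three_le_crOf [Finite V] {D : Set V} {u v w : V} (huv : u ≠ v) (huw : u ≠ w) (hvw : v ≠ w)
    (hu : ∃ s ∈ D, ∃ t ∈ D, s ≠ t ∧ (s = u ∨ G.Adj u s) ∧ (t = u ∨ G.Adj u t))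
    (hv : ∃ s ∈ D, ∃ t ∈ D, s ≠ t ∧ (s = v ∨ G.Adj v s) ∧ (t = v ∨ G.Adj v t))
    (hw : ∃ s ∈ D, ∃ t ∈ D, s ≠ t ∧ (s = w ∨ G.Adj w s) ∧ (t = w ∨ G.Adj w t)) :
    3 ≤ crOf G D := by
  have h3 : ({u, v, w} : Set V).ncard = 3 := Set.ncard_eq_three.2 ⟨u, v, w, huv, huw, hvw, rfl⟩
  rw [← h3]
  refine Set.ncard_le_ncard ?_ (Set.toFinite _)
  rintro z (rfl | rfl | rfl)
  · exact two_le_ncard_closedNbhd_inter.2 hu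
  · exact two_le_ncard_closedNbhd_inter.2 hv
  · exact two_le_ncard_closedNbhd_inter.2 hw

theorem crNum_eq_two_and_gammaCR_eq [Finite V] {S : Set V} (u v : V)
    (hS : ∀ w, ∃ s ∈ S, s = w ∨ G.Adj w s)
    (h : ∀ w, w ≠ u → w ≠ v → ∀ s ∈ S, ∀ t ∈ S,
      (s = w ∨ G.Adj w s) → (t = w ∨ G.Adj w t) → s = t)
    (h2 : ∀ D : Set V, (∀ w, ∃ s ∈ D, s = w ∨ G.Adj w s) →
      2 ≤ crOf G D ∧ (S.ncard ≤ D.ncard ∨ 3 ≤ crOf G D)) :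
    crNum G = 2 ∧ gammaCR G = S.ncard := by
  have hdom := isDomSet_iff.2 hS
  have hS2 : crOf G S = 2 := le_antisymm (crOf_le_two u v h) (h2 S hS).1
  have hcr : crNum G = 2 := by
    refine le_antisymm (hS2 ▸ crNum_le hdom) (le_csInf ⟨_, S, hdom, rfl⟩ ?_)
    rintro k ⟨D, hD, rfl⟩
    exact (h2 D (isDomSet_iff.1 hD)).1
  refine ⟨hcr, le_antisymm (gammaCR_le hdom (hS2.trans hcr.symm))
    (le_csInf ⟨_, S, hdom, hS2.trans hcr.symm, rfl⟩ ?_)⟩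
  rintro k ⟨D, hD, hD2, rfl⟩
  rcases (h2 D (isDomSet_iff.1 hD)).2 with h' | h'
  · exact h'
  · omega

end Basic

section Counting

open scoped Classical in
/-- The number of neighbors of `v` in `S`. -/
noncomputable def nbrsIn {V : Type*} (G : SimpleGraph V) (S : Finset V) (v : V) : ℕ :=
  (S.filter (G.Adj v)).card

variable {V : Type*} (G : SimpleGraph V)

theorem sum_nbrsIn_comm (S T : Finset V) :
    ∑ v ∈ S, nbrsIn G T v = ∑ v ∈ T, nbrsIn G S v := by
  classical
  simp only [nbrsIn, Finset.card_filter]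
  rw [Finset.sum_comm]
  simp only [G.adj_comm]

theorem two_mul_ncard_edgeSet [Fintype V] [DecidableEq V] (S : Finset V) :
    2 * G.edgeSet.ncard = ∑ v ∈ S, nbrsIn G S v + 2 * ∑ v ∈ Sᶜ, nbrsIn G S v +
      ∑ v ∈ Sᶜ, nbrsIn G Sᶜ v := by
  classical
  have h1 : 2 * G.edgeSet.ncard = ∑ v, G.degree v := by
    rw [G.sum_degrees_eq_twice_card_edges, ← Set.ncard_coe_finset, SimpleGraph.coe_edgeFinset]
  have h2 : ∀ v, G.degree v = nbrsIn G S v + nbrsIn G Sᶜ v := by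
    intro v
    rw [nbrsIn, nbrsIn, ← Finset.card_union_of_disjoint
      (Finset.disjoint_filter_filter disjoint_compl_right), ← Finset.filter_union,
      Finset.union_compl, ← SimpleGraph.card_neighborFinset_eq_degree]
    congr 1
    ext w
    simp
  simp only [h2] at h1
  rw [h1, ← Finset.sum_add_sum_compl S, Finset.sum_add_distrib, Finset.sum_add_distrib,
    sum_nbrsIn_comm G S Sᶜ]
  ring

theorem nbrsIn_le_card (S : Finset V) (v : V) : nbrsIn G S v ≤ S.card := by
  classical exact Finset.card_filter_le _ _

theorem nbrsIn_add_one_le {S : Finset V} {v u : V} (hu : u ∈ S) (h : ¬ G.Adj v u) :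
    nbrsIn G S v + 1 ≤ S.card := by
  classical
  exact Finset.card_lt_card (Finset.filter_ssubset.2 ⟨u, hu, h⟩)

theorem nbrsIn_add_two_le {S : Finset V} {v u w : V} (hu : u ∈ S) (hw : w ∈ S) (huw : u ≠ w)
    (h : ¬ G.Adj v u) (h' : ¬ G.Adj v w) : nbrsIn G S v + 2 ≤ S.card := by
  classical
  have : (S.filter (G.Adj v) ∪ {u, w}).card ≤ S.card :=
    Finset.card_le_card (by
      intro z hz
      simp only [Finset.mem_union, Finset.mem_filter, Finset.mem_insert,
        Finset.mem_singleton] at hz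
      rcases hz with hz | rfl | rfl
      exacts [hz.1, hu, hw])
  rwa [Finset.card_union_of_disjoint, Finset.card_pair huw] at this
  rw [Finset.disjoint_left]
  intro z hz hz'
  simp only [Finset.mem_filter, Finset.mem_insert, Finset.mem_singleton] at hz hz'
  rcases hz' with rfl | rfl
  exacts [h hz.2, h' hz.2]

theorem nbrsIn_eq_one {S : Finset V} {v s : V} (hs : s ∈ S) (h : G.Adj v s)
    (huniq : ∀ t ∈ S, G.Adj v t → t = s) : nbrsIn G S v = 1 := by
  classical
  rw [nbrsIn, Finset.card_eq_one]
  refine ⟨s, ?_⟩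
  ext t
  simp only [Finset.mem_filter, Finset.mem_singleton]
  exact ⟨fun ht => huniq t ht.1 ht.2, by rintro rfl; exact ⟨hs, h⟩⟩

theorem nbrsIn_eq_zero {S : Finset V} {v : V} (h : ∀ t ∈ S, ¬ G.Adj v t) : nbrsIn G S v = 0 := by
  classical
  rw [nbrsIn, Finset.card_eq_zero, Finset.filter_eq_empty_iff]
  exact fun t ht => h t ht

theorem adj_of_card_le_nbrsIn {S : Finset V} {v u : V} (hu : u ∈ S) (h : S.card ≤ nbrsIn G S v) :
    G.Adj v u := by
  by_contra hc
  have := nbrsIn_add_one_le G hu hc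
  omega

theorem adj_of_card_le_nbrsIn_add_one {S : Finset V} {v u : V} (hv : v ∈ S) (hu : u ∈ S)
    (huv : u ≠ v) (h : S.card ≤ nbrsIn G S v + 1) : G.Adj v u := by
  by_contra hc
  have := nbrsIn_add_two_le G hv hu huv.symm G.irrefl hc
  omega

end Counting

section UpperBound

variable {V : Type*} {G : SimpleGraph V}

/-- Two vertices `x`, `y` outside the independent set `S` have several neighbors in `S`, all
other vertices outside `S` have exactly one. -/
structure IsIndepConfig (G : SimpleGraph V) (S : Finset V) (x y : V) : Prop where
  ne : x ≠ y
  notMem_left : x ∉ S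
  notMem_right : y ∉ S
  indep : ∀ s ∈ S, ∀ t ∈ S, ¬ G.Adj s t
  two_left : ∃ s ∈ S, ∃ t ∈ S, s ≠ t ∧ G.Adj x s ∧ G.Adj x t
  two_right : ∃ s ∈ S, ∃ t ∈ S, s ≠ t ∧ G.Adj y s ∧ G.Adj y t
  existsUnique : ∀ w, w ∉ S → w ≠ x → w ≠ y → ∃ s ∈ S, G.Adj w s ∧ ∀ t ∈ S, G.Adj w t → t = s

theorem IsIndepConfig.symm {S : Finset V} {x y : V} (h : IsIndepConfig G S x y) :
    IsIndepConfig G S y x where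
  ne := h.ne.symm
  notMem_left := h.notMem_right
  notMem_right := h.notMem_left
  indep := h.indep
  two_left := h.two_right
  two_right := h.two_left
  existsUnique w hw h1 h2 := h.existsUnique w hw h2 h1

theorem exists_gammaCR_set [Fintype V] (hcr : crNum G = 2) (hr : 0 < gammaCR G) :
    ∃ S : Finset V, S.card = gammaCR G ∧ (∀ w, ∃ s ∈ S, s = w ∨ G.Adj w s) ∧
      ∃ x y, x ≠ y ∧
        (∃ s ∈ S, ∃ t ∈ S, s ≠ t ∧ (s = x ∨ G.Adj x s) ∧ (t = x ∨ G.Adj x t)) ∧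
        (∃ s ∈ S, ∃ t ∈ S, s ≠ t ∧ (s = y ∨ G.Adj y s) ∧ (t = y ∨ G.Adj y t)) ∧
        ∀ w, w ≠ x → w ≠ y → ∀ s ∈ S, ∀ t ∈ S,
          (s = w ∨ G.Adj w s) → (t = w ∨ G.Adj w t) → s = t := by
  classical
  obtain ⟨S, hS, hS2, hSr⟩ := Nat.sInf_mem (Nat.nonempty_of_pos_sInf hr)
  rw [hcr] at hS2
  obtain ⟨x, y, hxy, hover⟩ := Set.ncard_eq_two.1 hS2
  have hmem : ∀ w, (∃ s ∈ S, ∃ t ∈ S, s ≠ t ∧ (s = w ∨ G.Adj w s) ∧ (t = w ∨ G.Adj w t)) ↔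
      w = x ∨ w = y := by
    intro w
    rw [← two_le_ncard_closedNbhd_inter]
    exact Set.ext_iff.1 hover w
  refine ⟨S.toFinset, ?_, ?_, x, y, hxy, ?_, ?_, ?_⟩
  · rw [← Set.ncard_eq_toFinset_card']
    exact hSr
  · simpa using isDomSet_iff.1 hS
  · simpa using (hmem x).2 (Or.inl rfl)
  · simpa using (hmem y).2 (Or.inr rfl)
  · intro w hx hy s hs t ht h1 h2
    by_contra hne
    rcases (hmem w).1 ⟨s, by simpa using hs, t, by simpa using ht, hne, h1, h2⟩ with h | h
    exacts [hx h, hy h]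

variable [Fintype V] [DecidableEq V]

theorem sum_nbrsIn_compl_le {S : Finset V} {k : ℕ} (hk : Sᶜ.card = k + 1) :
    ∑ v ∈ Sᶜ, nbrsIn G Sᶜ v ≤ (k + 1) * k := by
  rw [← hk, ← smul_eq_mul]
  refine Finset.sum_le_card_nsmul _ _ _ fun v hv => ?_
  have := nbrsIn_add_one_le G hv (G.irrefl (v := v))
  omega

theorem edges_le_of_adj {S : Finset V} {x y : V} {k : ℕ} (hk : Sᶜ.card = k + 1)
    (hdom : ∀ w, ∃ s ∈ S, s = w ∨ G.Adj w s) (hx : x ∈ S) (hy : y ∈ S) (hxy : G.Adj x y)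
    (h : ∀ w, w ≠ x → w ≠ y → ∀ s ∈ S, ∀ t ∈ S,
          (s = w ∨ G.Adj w s) → (t = w ∨ G.Adj w t) → s = t) :
    2 * G.edgeSet.ncard ≤ 2 + 2 * (k + 1) + (k + 1) * k := by
  have hindep : ∀ s ∈ S, s ≠ x → s ≠ y → ∀ t ∈ S, ¬ G.Adj s t := by
    intro s hs h1 h2 t ht hst
    exact hst.ne (h s h1 h2 s hs t ht (Or.inl rfl) (Or.inr hst))
  have h1 : ∑ v ∈ S, nbrsIn G S v = 2 := by
    have hsub : ({x, y} : Finset V) ⊆ S := by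
      intro z hz
      simp only [Finset.mem_insert, Finset.mem_singleton] at hz
      rcases hz with rfl | rfl <;> assumption
    rw [← Finset.sum_subset hsub, Finset.sum_pair hxy.ne, nbrsIn_eq_one G hy hxy,
      nbrsIn_eq_one G hx hxy.symm]
    · intro t ht hyt
      by_contra hc
      exact hindep t ht hc hyt.ne' y hy hyt.symm
    · intro t ht hxt
      by_contra hc
      exact hindep t ht hxt.ne' hc x hx hxt.symm
    · intro z hz hz'
      simp only [Finset.mem_insert, Finset.mem_singleton, not_or] at hz'
      exact nbrsIn_eq_zero G (hindep z hz hz'.1 hz'.2)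
  have h2 : ∑ v ∈ Sᶜ, nbrsIn G S v = k + 1 := by
    rw [← hk, Finset.card_eq_sum_ones]
    refine Finset.sum_congr rfl fun v hv => ?_
    rw [Finset.mem_compl] at hv
    have hvx : v ≠ x := fun hc => hv (hc ▸ hx)
    have hvy : v ≠ y := fun hc => hv (hc ▸ hy)
    obtain ⟨s, hs, hs'⟩ := hdom v
    have hvs : G.Adj v s := hs'.resolve_left fun hc => hv (hc ▸ hs)
    exact nbrsIn_eq_one G hs hvs fun t ht hvt =>
      h v hvx hvy t ht s hs (Or.inr hvt) (Or.inr hvs)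
  rw [two_mul_ncard_edgeSet G S, h1, h2]
  have := sum_nbrsIn_compl_le (G := G) hk
  omega

theorem edges_le_or_isIndepConfig (hcr : crNum G = 2) {k : ℕ} (hr : 0 < gammaCR G)
    (hk : Fintype.card V = gammaCR G + (k + 1)) :
    2 * G.edgeSet.ncard ≤ 2 + 2 * (k + 1) + (k + 1) * k ∨
      ∃ S : Finset V, S.card = gammaCR G ∧ ∃ x y, IsIndepConfig G S x y := by
  obtain ⟨S, hSc, hdom, x, y, hxy, hx, hy, h⟩ := exists_gammaCR_set hcr hr
  have hk' : Sᶜ.card = k + 1 := by rw [Finset.card_compl]; omega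
  by_cases hind : ∃ s ∈ S, ∃ t ∈ S, G.Adj s t
  · left
    obtain ⟨s, hs, t, ht, hst⟩ := hind
    have hs' : s = x ∨ s = y := by
      by_contra! hc
      exact hst.ne (h s hc.1 hc.2 s hs t ht (Or.inl rfl) (Or.inr hst))
    have ht' : t = x ∨ t = y := by
      by_contra! hc
      exact hst.ne' (h t hc.1 hc.2 t ht s hs (Or.inl rfl) (Or.inr hst.symm))
    have hne := hst.ne
    rcases hs' with rfl | rfl <;> rcases ht' with rfl | rfl
    · exact absurd rfl hne
    · exact edges_le_of_adj hk' hdom hs ht hst h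
    · exact edges_le_of_adj hk' hdom ht hs hst.symm h
    · exact absurd rfl hne
  · push Not at hind
    right
    have hout : ∀ z, (∃ s ∈ S, ∃ t ∈ S, s ≠ t ∧ (s = z ∨ G.Adj z s) ∧ (t = z ∨ G.Adj z t)) →
        z ∉ S := by
      rintro z ⟨s, hs, t, ht, hne, h1, h2⟩ hz
      have := hind z hz s hs
      have := hind z hz t ht
      grind
    refine ⟨S, hSc, x, y, hxy, hout x hx, hout y hy, hind, ?_, ?_, ?_⟩
    · have := hout x hx
      grind
    · have := hout y hy
      grind
    · intro w hw hwx hwy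
      obtain ⟨s, hs, hs'⟩ := hdom w
      have hws : G.Adj w s := hs'.resolve_left fun hc => hw (hc ▸ hs)
      exact ⟨s, hs, hws, fun t ht hwt => h w hwx hwy t ht s hs (Or.inr hwt) (Or.inr hws)⟩

end UpperBound

section IndepConfig

variable {V : Type*} [Fintype V] [DecidableEq V] {G : SimpleGraph V} {S : Finset V} {x y : V}

theorem exists_not_adj (hcr : crNum G = 2) (hr : 2 ≤ gammaCR G) (x : V) :
    ∃ v, v ≠ x ∧ ¬ G.Adj x v := by
  by_contra! hc
  have := gammaCR_le_of_overdominated hcr (D := {x}) x x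
    (fun w => ⟨x, rfl, by
      by_cases h : w = x
      · exact Or.inl h.symm
      · exact Or.inr (hc w h).symm⟩)
    (by rintro w - - s rfl t rfl - -; rfl)
  rw [Set.ncard_singleton] at this
  omega

/-- If exchanging the part `R` of a `γ_CR`-set for `A` keeps the set dominating with at most two
overdominated vertices, then `A` is at least as large as `R`. -/
theorem card_le_card_of_exchange (hcr : crNum G = 2) (hS : S.card = gammaCR G) {A R : Finset V}
    (hR : R ⊆ S) (u v : V)
    (hD : ∀ w, ∃ d, (d ∈ A ∨ (d ∈ S ∧ d ∉ R)) ∧ (d = w ∨ G.Adj w d))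
    (h : ∀ w, w ≠ u → w ≠ v → ∀ s, (s ∈ A ∨ (s ∈ S ∧ s ∉ R)) → ∀ t, (t ∈ A ∨ (t ∈ S ∧ t ∉ R)) →
      (s = w ∨ G.Adj w s) → (t = w ∨ G.Adj w t) → s = t) : R.card ≤ A.card := by
  have h1 := gammaCR_le_of_overdominated hcr (D := ↑(A ∪ S \ R)) u v
    (by simpa using hD) (by simpa using h)
  rw [Set.ncard_coe_finset, ← hS] at h1
  have h2 := Finset.card_union_le A (S \ R)
  have h3 := Finset.card_sdiff_add_card_eq_card hR
  omega

theorem IsIndepConfig.two_mul_ncard_edgeSet (hc : IsIndepConfig G S x y) {m : ℕ}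
    (hm : Sᶜ.card = m + 2) :
    ((Sᶜ.erase x).erase y).card = m ∧
    2 * G.edgeSet.ncard = 2 * (nbrsIn G S x + nbrsIn G S y + m) +
      (nbrsIn G Sᶜ x + nbrsIn G Sᶜ y + ∑ v ∈ (Sᶜ.erase x).erase y, nbrsIn G Sᶜ v) := by
  have hx : x ∈ Sᶜ := Finset.mem_compl.2 hc.notMem_left
  have hy : y ∈ Sᶜ.erase x := Finset.mem_erase.2 ⟨hc.ne.symm, Finset.mem_compl.2 hc.notMem_right⟩
  have hcard : ((Sᶜ.erase x).erase y).card = m := by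
    rw [Finset.card_erase_of_mem hy, Finset.card_erase_of_mem hx]
    omega
  refine ⟨hcard, ?_⟩
  have h0 : ∑ v ∈ S, nbrsIn G S v = 0 :=
    Finset.sum_eq_zero fun v hv => nbrsIn_eq_zero G (hc.indep v hv)
  have h1 : ∑ v ∈ (Sᶜ.erase x).erase y, nbrsIn G S v = m := by
    rw [← hcard, Finset.card_eq_sum_ones]
    refine Finset.sum_congr rfl fun v hv => ?_
    simp only [Finset.mem_erase, Finset.mem_compl] at hv
    obtain ⟨s, hs, hvs, hu⟩ := hc.existsUnique v hv.2.2 hv.2.1 hv.1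
    exact nbrsIn_eq_one G hs hvs hu
  rw [_root_.two_mul_ncard_edgeSet G S, h0, ← Finset.add_sum_erase _ _ hx,
    ← Finset.add_sum_erase _ _ hy, h1, ← Finset.add_sum_erase _ (nbrsIn G Sᶜ) hx,
    ← Finset.add_sum_erase _ (nbrsIn G Sᶜ) hy]
  ring

theorem nbrsIn_add_le (hcr : crNum G = 2) (hr : 2 ≤ gammaCR G) {x : V} (hx : x ∉ S) {m : ℕ}
    (hm : Sᶜ.card = m + 2) : 2 * nbrsIn G S x + nbrsIn G Sᶜ x ≤ 2 * S.card + m := by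
  have hx' : x ∈ Sᶜ := Finset.mem_compl.2 hx
  have h1 := nbrsIn_le_card G S x
  have h2 := nbrsIn_add_one_le G hx' (G.irrefl (v := x))
  obtain ⟨v, hv, hxv⟩ := exists_not_adj hcr hr x
  by_cases h : v ∈ S
  · have := nbrsIn_add_one_le G h hxv
    omega
  · have := nbrsIn_add_two_le G hx' (Finset.mem_compl.2 h) hv.symm G.irrefl hxv
    omega

theorem IsIndepConfig.edges_le (hc : IsIndepConfig G S x y) (hcr : crNum G = 2)
    (hr : 2 ≤ gammaCR G) {m : ℕ} (hm : Sᶜ.card = m + 2) :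
    2 * G.edgeSet.ncard ≤ 4 * S.card + 4 * m + m * (m + 1) := by
  obtain ⟨hM, hE⟩ := hc.two_mul_ncard_edgeSet hm
  have h1 := nbrsIn_add_le hcr hr hc.notMem_left hm
  have h2 := nbrsIn_add_le hcr hr hc.notMem_right hm
  have h3 : ∑ v ∈ (Sᶜ.erase x).erase y, nbrsIn G Sᶜ v ≤ m * (m + 1) := by
    refine (Finset.sum_le_card_nsmul _ _ (m + 1) fun v hv => ?_).trans_eq
      (by rw [hM, smul_eq_mul])
    have := nbrsIn_add_one_le G (Finset.mem_of_mem_erase (Finset.mem_of_mem_erase hv))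
      (G.irrefl (v := v))
    omega
  omega

theorem IsIndepConfig.edges_lt (hc : IsIndepConfig G S x y) (hcr : crNum G = 2)
    (hS : S.card = gammaCR G) (hr : 3 ≤ gammaCR G) {m : ℕ} (hm : Sᶜ.card = m + 2)
    (hmr : m < S.card) :
    2 * G.edgeSet.ncard < 4 * S.card + 4 * m + m * (m + 1) := by
  by_contra! hge
  obtain ⟨hM, hE⟩ := hc.two_mul_ncard_edgeSet hm
  have h1 := nbrsIn_add_le hcr (by omega) hc.notMem_left hm
  have h2 := nbrsIn_add_le hcr (by omega) hc.notMem_right hm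
  have hx' : x ∈ Sᶜ := Finset.mem_compl.2 hc.notMem_left
  have hy' : y ∈ Sᶜ := Finset.mem_compl.2 hc.notMem_right
  have hle : ∀ v ∈ (Sᶜ.erase x).erase y, nbrsIn G Sᶜ v ≤ m + 1 := by
    intro v hv
    have := nbrsIn_add_one_le G (Finset.mem_of_mem_erase (Finset.mem_of_mem_erase hv))
      (G.irrefl (v := v))
    omega
  have hsum : ∑ v ∈ (Sᶜ.erase x).erase y, (m + 1) = m * (m + 1) := by
    rw [Finset.sum_const, hM, smul_eq_mul]
  have h3 := Finset.sum_le_sum hle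
  have heq := (Finset.sum_eq_sum_iff_of_le hle).1 (by omega)
  have hx1 := nbrsIn_le_card G S x
  have hx2 := nbrsIn_add_one_le G hx' (G.irrefl (v := x))
  have hy1 := nbrsIn_le_card G S y
  have hMadj : ∀ v, v ∉ S → v ≠ x → v ≠ y → ∀ w, w ∉ S → w ≠ v → G.Adj v w := by
    intro v hv hvx hvy w hw hwv
    refine adj_of_card_le_nbrsIn_add_one G (Finset.mem_compl.2 hv) (Finset.mem_compl.2 hw) hwv ?_
    rw [heq v (by simp [hv, hvx, hvy])]
    omega
  have hxS : ∀ s ∈ S, G.Adj x s := fun s hs => adj_of_card_le_nbrsIn G hs (by omega)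
  have hyS : ∀ s ∈ S, G.Adj y s := fun s hs => adj_of_card_le_nbrsIn G hs (by
    have hy2 := nbrsIn_add_one_le G hy' (G.irrefl (v := y))
    omega)
  have hxy : ¬ G.Adj x y := by
    intro hadj
    obtain ⟨v, hv, hxv⟩ := exists_not_adj hcr (by omega) x
    by_cases hvS : v ∈ S
    · exact hxv (hxS v hvS)
    · by_cases hvy : v = y
      · exact hxv (hvy ▸ hadj)
      · exact hxv (hMadj v hvS hv hvy x hc.notMem_left hv.symm).symm
  choose! f hfS hf hfu using hc.existsUnique
  obtain ⟨s, hs, hsf⟩ : ∃ s ∈ S, s ∉ ((Sᶜ.erase x).erase y).image f := by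
    refine Finset.exists_mem_notMem_of_card_lt_card (lt_of_le_of_lt Finset.card_image_le ?_)
    omega
  have hsM : ∀ v, v ∉ S → v ≠ x → v ≠ y → ¬ G.Adj v s := by
    intro v hv hvx hvy hadj
    exact hsf (Finset.mem_image.2 ⟨v, by simp [hv, hvx, hvy], (hfu v hv hvx hvy s hs hadj).symm⟩)
  have hind := hc.indep
  have hxn := hc.notMem_left
  have h := card_le_card_of_exchange hcr hS (A := {x, s}) (R := S) subset_rfl x s
    (by
      intro w
      by_cases hw : w ∈ S
      · exact ⟨x, by simp, Or.inr (hxS w hw).symm⟩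
      · by_cases hwy : w = y
        · exact ⟨s, by simp, Or.inr (hwy ▸ hyS s hs)⟩
        · by_cases hwx : w = x
          · exact ⟨x, by simp, Or.inl hwx.symm⟩
          · exact ⟨x, by simp, Or.inr (hMadj w hw hwx hwy x hxn (Ne.symm hwx))⟩)
    (by
      intro w hwx hws d hd t ht hd' ht'
      simp only [Finset.mem_insert, Finset.mem_singleton] at hd ht
      by_contra hne
      have hx0 : x = w ∨ G.Adj w x := by grind
      have hs0 : s = w ∨ G.Adj w s := by grind
      have hwx' := hx0.resolve_left (Ne.symm hwx)
      have hws' := hs0.resolve_left (Ne.symm hws)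
      by_cases hw : w ∈ S
      · exact hind w hw s hs hws'
      · by_cases hwy : w = y
        · exact hxy (hwy ▸ hwx'.symm)
        · exact hsM w hw hwx hwy hws')
  have := Finset.card_le_two (a := x) (b := s)
  omega

omit [Fintype V] [DecidableEq V] in
theorem IsIndepConfig.two_le_nbrsIn (hc : IsIndepConfig G S x y) : 2 ≤ nbrsIn G S x := by
  classical
  obtain ⟨s, hs, t, ht, hst, hxs, hxt⟩ := hc.two_left
  exact Finset.one_lt_card.2 ⟨s, by simp [hs, hxs], t, by simp [ht, hxt], hst⟩

omit [Fintype V] [DecidableEq V] in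
theorem nbrsIn_eq_of_iff {x y : V} (h : ∀ s ∈ S, G.Adj x s ↔ G.Adj y s) :
    nbrsIn G S x = nbrsIn G S y := by
  classical
  rw [nbrsIn, nbrsIn, Finset.filter_congr h]

/-- Exchanging the neighbors of `x` in `S` for `A`. -/
theorem nbrsIn_le_card_of_exchange (hcr : crNum G = 2) (hS : S.card = gammaCR G) {A : Finset V}
    (x u v : V)
    (hD : ∀ w, ∃ d, (d ∈ A ∨ (d ∈ S ∧ ¬ G.Adj x d)) ∧ (d = w ∨ G.Adj w d))
    (h : ∀ w, w ≠ u → w ≠ v → ∀ s, (s ∈ A ∨ (s ∈ S ∧ ¬ G.Adj x s)) →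
      ∀ t, (t ∈ A ∨ (t ∈ S ∧ ¬ G.Adj x t)) →
      (s = w ∨ G.Adj w s) → (t = w ∨ G.Adj w t) → s = t) : nbrsIn G S x ≤ A.card := by
  classical
  have hiff : ∀ d, (d ∈ S ∧ d ∉ S.filter (G.Adj x)) ↔ (d ∈ S ∧ ¬ G.Adj x d) := by
    intro d
    simp only [Finset.mem_filter]
    tauto
  refine card_le_card_of_exchange hcr hS (Finset.filter_subset (G.Adj x) S) u v ?_ ?_
  · simpa only [hiff] using hD
  · simpa only [hiff] using h

theorem IsIndepConfig.edges_le_of_card_compl_eq_two (hc : IsIndepConfig G S x y)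
    (hcr : crNum G = 2) (hS : S.card = gammaCR G) (hm : Sᶜ.card = 2) :
    2 * G.edgeSet.ncard ≤ 8 := by
  classical
  obtain ⟨hM, hE⟩ := hc.two_mul_ncard_edgeSet (m := 0) hm
  have hcov : ∀ w, w ∈ S ∨ w = x ∨ w = y := by
    intro w
    by_contra! hw
    have : w ∈ (Sᶜ.erase x).erase y := by simp [hw]
    rw [Finset.card_eq_zero.1 hM] at this
    simp at this
  rw [Finset.card_eq_zero.1 hM, Finset.sum_empty] at hE
  have key : ∀ {x y}, IsIndepConfig G S x y → (∀ w, w ∈ S ∨ w = x ∨ w = y) →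
      ¬ G.Adj x y ∧ ∀ s ∈ S, G.Adj y s → G.Adj x s := by
    intro x y hc hcov
    have h2 := hc.two_le_nbrsIn
    have hind := hc.indep
    have hxS := hc.notMem_left
    by_contra hcon
    have hcon' : G.Adj x y ∨ ∃ s ∈ S, G.Adj y s ∧ ¬ G.Adj x s := by grind
    have := nbrsIn_le_card_of_exchange hcr hS (A := {x}) x y y
      (by
        simp only [Finset.mem_singleton]
        intro w
        have := G.adj_comm w x
        grind)
      (by
        simp only [Finset.mem_singleton]
        intro w
        have := G.adj_comm w x
        grind)
    simp only [Finset.card_singleton] at this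
    omega
  obtain ⟨hxy, h1⟩ := key hc hcov
  obtain ⟨-, h2⟩ := key hc.symm (by grind)
  have hab : nbrsIn G S x = nbrsIn G S y :=
    nbrsIn_eq_of_iff fun s hs => ⟨h2 s hs, h1 s hs⟩
  obtain ⟨s, hs, -, -, -, hxs, -⟩ := hc.two_left
  have hind := hc.indep
  have hxS := hc.notMem_left
  have hle := nbrsIn_le_card_of_exchange hcr hS (A := {x, s}) x x s
    (by
      simp only [Finset.mem_singleton, Finset.mem_insert]
      intro w
      have := G.adj_comm w x
      grind)
    (by
      simp only [Finset.mem_singleton, Finset.mem_insert]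
      intro w
      have := G.adj_comm w x
      grind)
  have hle2 := Finset.card_le_two (a := x) (b := s)
  have hx := nbrsIn_add_two_le G (v := x) (Finset.mem_compl.2 hc.notMem_left)
    (Finset.mem_compl.2 hc.notMem_right) hc.ne G.irrefl hxy
  have hy := nbrsIn_add_two_le G (v := y) (Finset.mem_compl.2 hc.notMem_right)
    (Finset.mem_compl.2 hc.notMem_left) hc.ne.symm G.irrefl (fun h => hxy h.symm)
  omega

/-- An `IsIndepConfig` with exactly one further vertex `z`, whose neighbor in `S` is `p`. -/
structure IsIndepConfigThree (G : SimpleGraph V) (S : Finset V) (x y z p : V) : Prop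
    extends IsIndepConfig G S x y where
  ne_left : z ≠ x
  ne_right : z ≠ y
  notMem : z ∉ S
  cover : ∀ w, w ∈ S ∨ w = x ∨ w = y ∨ w = z
  mem : p ∈ S
  adj : G.Adj z p
  unique : ∀ t ∈ S, G.Adj z t → t = p

namespace IsIndepConfigThree

variable {z p : V}

omit [Fintype V] [DecidableEq V] in
protected theorem symm (hc : IsIndepConfigThree G S x y z p) : IsIndepConfigThree G S y x z p where
  toIsIndepConfig := hc.toIsIndepConfig.symm
  ne_left := hc.ne_right
  ne_right := hc.ne_left
  notMem := hc.notMem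
  cover w := by
    have := hc.cover w
    tauto
  mem := hc.mem
  adj := hc.adj
  unique := hc.unique

theorem undominated (hc : IsIndepConfigThree G S x y z p) (hcr : crNum G = 2)
    (hS : S.card = gammaCR G) :
    (¬ G.Adj x y ∧ ∀ s ∈ S, G.Adj y s → G.Adj x s) ∨ (¬ G.Adj x z ∧ G.Adj x p) := by
  have h2 := hc.two_le_nbrsIn
  obtain ⟨⟨hxy, hxS, hyS, hind, -, -, -⟩, hzx, hzy, hzS, hcov, hp, hzp, hpu⟩ := hc
  by_contra hcon
  have hcon1 : G.Adj x y ∨ ∃ s ∈ S, G.Adj y s ∧ ¬ G.Adj x s := by grind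
  have hcon2 : G.Adj x z ∨ ¬ G.Adj x p := by grind
  have := nbrsIn_le_card_of_exchange hcr hS (A := {x}) x y z
    (by
      simp only [Finset.mem_singleton]
      intro w
      have := G.adj_comm w x
      grind)
    (by
      simp only [Finset.mem_singleton]
      intro w
      have := G.adj_comm w x
      grind)
  simp only [Finset.card_singleton] at this
  omega

theorem nbrsIn_le_two_of_subset (hc : IsIndepConfigThree G S x y z p) (hcr : crNum G = 2)
    (hS : S.card = gammaCR G) (hxy : ¬ G.Adj x y) (hsub : ∀ s ∈ S, G.Adj y s → G.Adj x s)
    (hyp : G.Adj y p ∨ (¬ G.Adj x z ∧ ¬ G.Adj x p)) : nbrsIn G S x ≤ 2 := by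
  obtain ⟨⟨hne, hxS, hyS, hind, -, h2, -⟩, hzx, hzy, hzS, hcov, hp, hzp, hpu⟩ := hc
  obtain ⟨s, hs, hys, hsp⟩ : ∃ s ∈ S, G.Adj y s ∧
      ((G.Adj x p ∧ ((G.Adj x z ∧ s ≠ p) ∨ (¬ G.Adj x z ∧ s = p))) ∨
        (¬ G.Adj x p ∧ ¬ G.Adj x z)) := by
    obtain ⟨s, hs, t, ht, hst, hys, hyt⟩ := h2
    grind
  refine (nbrsIn_le_card_of_exchange hcr hS (A := {x, s}) x x s ?_ ?_).trans Finset.card_le_two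
  · simp only [Finset.mem_singleton, Finset.mem_insert]
    intro w
    have := G.adj_comm w x
    grind
  · simp only [Finset.mem_singleton, Finset.mem_insert]
    intro w
    have := G.adj_comm w x
    grind

theorem nbrsIn_le_two_of_not_subset (hc : IsIndepConfigThree G S x y z p) (hcr : crNum G = 2)
    (hS : S.card = gammaCR G) (hxz : ¬ G.Adj x z) (hxp : G.Adj x p)
    (hy : G.Adj x y ∨ ∃ s ∈ S, G.Adj y s ∧ ¬ G.Adj x s) : nbrsIn G S x ≤ 2 := by
  obtain ⟨⟨hne, hxS, hyS, hind, -, -, -⟩, hzx, hzy, hzS, hcov, hp, hzp, hpu⟩ := hc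
  refine (nbrsIn_le_card_of_exchange hcr hS (A := {x, z}) x y p ?_ ?_).trans Finset.card_le_two
  · simp only [Finset.mem_singleton, Finset.mem_insert]
    intro w
    have := G.adj_comm w x
    grind
  · simp only [Finset.mem_singleton, Finset.mem_insert]
    intro w hwy hwp
    have := G.adj_comm w x
    have := G.adj_comm w z
    have := hcov w
    have h1 : (x = w ∨ G.Adj w x) → (z = w ∨ G.Adj w z) → False := by grind
    have h2 : ∀ s, s ∈ S ∧ ¬ G.Adj x s → (s = w ∨ G.Adj w s) → s = w := by grind
    grind

theorem not_adj_of_nbrs_eq (hc : IsIndepConfigThree G S x y z p) (hcr : crNum G = 2)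
    (hS : S.card = gammaCR G) (hxy : ¬ G.Adj x y) (heq : ∀ s ∈ S, G.Adj x s ↔ G.Adj y s)
    (hxp : ¬ G.Adj x p) : ¬ G.Adj y z := by
  classical
  intro hyz
  have h2 := hc.two_le_nbrsIn
  obtain ⟨⟨hne, hxS, hyS, hind, -, -, -⟩, hzx, hzy, hzS, hcov, hp, hzp, hpu⟩ := hc
  have hpn : p ∉ S.filter (G.Adj x) := by simp [hxp]
  have h := card_le_card_of_exchange hcr hS (A := {x, z}) (R := insert p (S.filter (G.Adj x)))
    (Finset.insert_subset hp (Finset.filter_subset _ _)) x z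
    (by
      simp only [Finset.mem_singleton, Finset.mem_insert, Finset.mem_filter]
      intro w
      have := G.adj_comm w x
      have := G.adj_comm w z
      grind)
    (by
      simp only [Finset.mem_singleton, Finset.mem_insert, Finset.mem_filter]
      intro w
      have := G.adj_comm w x
      have := G.adj_comm w z
      grind)
  rw [Finset.card_insert_of_notMem hpn] at h
  have h' := Finset.card_le_two (a := x) (b := z)
  simp only [nbrsIn] at h2
  omega

theorem two_mul_ncard_edgeSet_le (hc : IsIndepConfigThree G S x y z p) (hcr : crNum G = 2)
    (hS : S.card = gammaCR G) (hm : Sᶜ.card = 3) :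
    2 * (nbrsIn G S x + nbrsIn G S y + 1) +
      (nbrsIn G Sᶜ x + nbrsIn G Sᶜ y + nbrsIn G Sᶜ z) ≤ 14 := by
  have hx' := Finset.mem_compl.2 hc.notMem_left
  have hy' := Finset.mem_compl.2 hc.notMem_right
  have hz' := Finset.mem_compl.2 hc.notMem
  have h2x := hc.two_le_nbrsIn
  have h2y := hc.symm.two_le_nbrsIn
  have hxT := nbrsIn_add_one_le G hx' (G.irrefl (v := x))
  have hyT := nbrsIn_add_one_le G hy' (G.irrefl (v := y))
  have hzT := nbrsIn_add_one_le G hz' (G.irrefl (v := z))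
  have hxyT : ¬ G.Adj x y → nbrsIn G Sᶜ x + 2 ≤ 3 ∧ nbrsIn G Sᶜ y + 2 ≤ 3 := fun h =>
    ⟨hm ▸ nbrsIn_add_two_le G hx' hy' hc.ne G.irrefl h,
      hm ▸ nbrsIn_add_two_le G hy' hx' hc.ne.symm G.irrefl fun h' => h h'.symm⟩
  have hsymm : G.Adj x y ↔ G.Adj y x := G.adj_comm x y
  rcases hc.undominated hcr hS with ⟨hxy, hsub⟩ | ⟨hxz, hxp⟩
  · have hT := hxyT hxy
    by_cases hsub' : ∀ s ∈ S, G.Adj x s → G.Adj y s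
    · have heq : ∀ s ∈ S, G.Adj x s ↔ G.Adj y s := fun s hs => ⟨hsub' s hs, hsub s hs⟩
      have hab : nbrsIn G S x = nbrsIn G S y := nbrsIn_eq_of_iff heq
      have hle : nbrsIn G S x ≤ 2 := by
        by_cases hyp : G.Adj y p
        · exact hc.nbrsIn_le_two_of_subset hcr hS hxy hsub (Or.inl hyp)
        · have hxp : ¬ G.Adj x p := fun h => hyp (hsub' p hc.mem h)
          by_cases hxz : G.Adj x z
          · rw [hab]
            exact hc.symm.nbrsIn_le_two_of_subset hcr hS (fun h => hxy h.symm) hsub'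
              (Or.inr ⟨hc.not_adj_of_nbrs_eq hcr hS hxy heq hxp, hyp⟩)
          · exact hc.nbrsIn_le_two_of_subset hcr hS hxy hsub (Or.inr ⟨hxz, hxp⟩)
      omega
    · rcases hc.symm.undominated hcr hS with ⟨-, h⟩ | ⟨hyz, hyp⟩
      · exact absurd h hsub'
      · have hx2 := hc.nbrsIn_le_two_of_subset hcr hS hxy hsub (Or.inl hyp)
        have hyle : nbrsIn G S y ≤ nbrsIn G S x := by
          classical
          refine Finset.card_le_card fun s => ?_
          simp only [Finset.mem_filter]
          exact fun ⟨hs, hys⟩ => ⟨hs, hsub s hs hys⟩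
        omega
  · rcases hc.symm.undominated hcr hS with ⟨hyx, hsub⟩ | ⟨hyz, hyp⟩
    · have hT := hxyT (fun h => hyx h.symm)
      have hy2 := hc.symm.nbrsIn_le_two_of_subset hcr hS hyx hsub (Or.inl hxp)
      have hxle : nbrsIn G S x ≤ nbrsIn G S y := by
        classical
        refine Finset.card_le_card fun s => ?_
        simp only [Finset.mem_filter]
        exact fun ⟨hs, hys⟩ => ⟨hs, hsub s hs hys⟩
      omega
    · have hxz2 := nbrsIn_add_two_le G hx' hz' hc.ne_left.symm G.irrefl hxz
      have hyz2 := nbrsIn_add_two_le G hy' hz' hc.ne_right.symm G.irrefl hyz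
      have hzx2 := nbrsIn_add_two_le G hz' hx' hc.ne_left G.irrefl fun h => hxz h.symm
      by_cases hsub : ¬ G.Adj x y ∧ ∀ s ∈ S, G.Adj y s → G.Adj x s
      · have hx2 := hc.nbrsIn_le_two_of_subset hcr hS hsub.1 hsub.2 (Or.inl hyp)
        have hyle : nbrsIn G S y ≤ nbrsIn G S x := by
          classical
          refine Finset.card_le_card fun s => ?_
          simp only [Finset.mem_filter]
          exact fun ⟨hs, hys⟩ => ⟨hs, hsub.2 s hs hys⟩
        omega
      · have hx2 := hc.nbrsIn_le_two_of_not_subset hcr hS hxz hxp (by grind)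
        by_cases hsub' : ¬ G.Adj y x ∧ ∀ s ∈ S, G.Adj x s → G.Adj y s
        · have hy2 := hc.symm.nbrsIn_le_two_of_subset hcr hS hsub'.1 hsub'.2 (Or.inl hxp)
          omega
        · have hy2 := hc.symm.nbrsIn_le_two_of_not_subset hcr hS hyz hyp (by grind)
          omega

end IsIndepConfigThree

theorem IsIndepConfig.edges_le_of_card_compl_eq_three (hc : IsIndepConfig G S x y)
    (hcr : crNum G = 2) (hS : S.card = gammaCR G) (hm : Sᶜ.card = 3) :
    2 * G.edgeSet.ncard ≤ 14 := by
  obtain ⟨hM, hE⟩ := hc.two_mul_ncard_edgeSet (m := 1) hm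
  obtain ⟨z, hz⟩ := Finset.card_eq_one.1 hM
  have hzmem : z ∈ (Sᶜ.erase x).erase y := by simp [hz]
  simp only [Finset.mem_erase, Finset.mem_compl] at hzmem
  obtain ⟨hzy, hzx, hzS⟩ := hzmem
  have hcov : ∀ w, w ∈ S ∨ w = x ∨ w = y ∨ w = z := by
    intro w
    by_contra! hw
    have : w ∈ (Sᶜ.erase x).erase y := by simp [hw]
    rw [hz, Finset.mem_singleton] at this
    exact hw.2.2.2 this
  rw [hz, Finset.sum_singleton] at hE
  obtain ⟨p, hp, hzp, hpu⟩ := hc.existsUnique z hzS hzx hzy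
  rw [hE]
  exact IsIndepConfigThree.two_mul_ncard_edgeSet_le
    ⟨hc, hzx, hzy, hzS, hcov, hp, hzp, hpu⟩ hcr hS hm

end IndepConfig

section EdgeBounds

variable {V : Type*} [Fintype V] {G : SimpleGraph V}

theorem two_mul_choose_two (m : ℕ) : 2 * (m + 3).choose 2 = m * (m + 1) + 4 * m + 6 := by
  have h2 : (m + 3).choose 2 = (m + 3) * (m + 2) / 2 := Nat.choose_two_right _
  have h3 : Even ((m + 3) * (m + 2)) := by
    rw [mul_comm]; exact Nat.even_mul_succ_self (m + 2)
  obtain ⟨a, ha⟩ := h3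
  rw [h2, ha]
  have : (m + 3) * (m + 2) = m * (m + 1) + 4 * m + 6 := by ring
  omega

theorem exists_card_compl_eq_of_edges [DecidableEq V] (hcr : crNum G = 2) {m : ℕ}
    (hr : 2 ≤ gammaCR G) (hV : Fintype.card V = gammaCR G + m + 2) :
    G.edgeSet.ncard ≤ (m + 3).choose 2 + 1 ∨
      ∃ S : Finset V, S.card = gammaCR G ∧ Sᶜ.card = m + 2 ∧ ∃ x y, IsIndepConfig G S x y := by
  rcases edges_le_or_isIndepConfig hcr (k := m + 1) (by omega) (by omega) with h | ⟨S, hS, h⟩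
  · left
    have h2 := two_mul_choose_two m
    have : (m + 1 + 1) * (m + 1) = m * (m + 1) + 2 * m + 2 := by ring
    omega
  · exact Or.inr ⟨S, hS, by rw [Finset.card_compl]; omega, h⟩

theorem ncard_edgeSet_le (hcr : crNum G = 2) {m : ℕ} (hr : 2 ≤ gammaCR G)
    (hV : Fintype.card V = gammaCR G + m + 2) :
    G.edgeSet.ncard ≤ 2 * (gammaCR G - 2) + (m + 3).choose 2 + 1 := by
  classical
  rcases exists_card_compl_eq_of_edges hcr hr hV with h | ⟨S, hS, hm, x, y, hc⟩
  · omega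
  · have h := hc.edges_le hcr hr hm
    have := two_mul_choose_two m
    omega

theorem ncard_edgeSet_le_of_lt (hcr : crNum G = 2) {m : ℕ} (hr : 3 ≤ gammaCR G)
    (hV : Fintype.card V = gammaCR G + m + 2) (hmr : m < gammaCR G) :
    G.edgeSet.ncard ≤ 2 * (gammaCR G - 2) + (m + 3).choose 2 := by
  classical
  rcases exists_card_compl_eq_of_edges hcr (by omega) hV with h | ⟨S, hS, hm, x, y, hc⟩
  · omega
  · have h := hc.edges_lt hcr hS hr hm (by omega)
    have := two_mul_choose_two m
    omega

theorem ncard_edgeSet_le_four (hcr : crNum G = 2) (hr : 2 ≤ gammaCR G)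
    (hV : Fintype.card V = gammaCR G + 2) : G.edgeSet.ncard ≤ 4 := by
  classical
  rcases exists_card_compl_eq_of_edges (m := 0) hcr hr (by omega) with h | ⟨S, hS, hm, x, y, hc⟩
  · exact h
  · have := hc.edges_le_of_card_compl_eq_two hcr hS hm
    omega

theorem ncard_edgeSet_le_seven (hcr : crNum G = 2) (hr : 2 ≤ gammaCR G)
    (hV : Fintype.card V = gammaCR G + 3) : G.edgeSet.ncard ≤ 7 := by
  classical
  rcases exists_card_compl_eq_of_edges (m := 1) hcr hr (by omega) with h | ⟨S, hS, hm, x, y, hc⟩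
  · exact h
  · have := hc.edges_le_of_card_compl_eq_three hcr hS hm
    omega

end EdgeBounds

section Extremal

theorem ncard_le_of_indep {V : Type*} [Finite V] {G : SimpleGraph V} {S D : Set V}
    (hD : ∀ w, ∃ s ∈ D, s = w ∨ G.Adj w s)
    (h : ∀ w ∈ D, ∀ s ∈ S, ∀ t ∈ S, (s = w ∨ G.Adj w s) → (t = w ∨ G.Adj w t) → s = t) :
    S.ncard ≤ D.ncard := by
  choose f hf hfw using hD
  refine Set.ncard_le_ncard_of_injOn f (fun a _ => hf a) ?_ (Set.toFinite _)
  intro a ha b hb hab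
  refine h (f a) (hf a) a ha b hb ?_ ?_
  · exact (hfw a).imp Eq.symm fun h => h.symm
  · rw [hab]
    exact (hfw b).imp Eq.symm fun h => h.symm

theorem crNum_eq_two_and_gammaCR_eq_of_pair {V : Type*} [Finite V] {G : SimpleGraph V} {S : Set V}
    (u v : V) (hS : ∀ w, ∃ s ∈ S, s = w ∨ G.Adj w s)
    (h : ∀ w, w ≠ u → w ≠ v → ∀ s ∈ S, ∀ t ∈ S,
      (s = w ∨ G.Adj w s) → (t = w ∨ G.Adj w t) → s = t)
    (hout : ∀ D : Set V, (∀ w, ∃ s ∈ D, s = w ∨ G.Adj w s) → u ∉ D → v ∉ D → 2 ≤ crOf G D)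
    (hin : ∀ D : Set V, (∀ w, ∃ s ∈ D, s = w ∨ G.Adj w s) → u ∈ D ∨ v ∈ D →
      2 ≤ crOf G D ∧ (S.ncard ≤ D.ncard ∨ 3 ≤ crOf G D)) :
    crNum G = 2 ∧ gammaCR G = S.ncard := by
  refine crNum_eq_two_and_gammaCR_eq u v hS h fun D hD => ?_
  by_cases huv : u ∈ D ∨ v ∈ D
  · exact hin D hD huv
  · push Not at huv
    refine ⟨hout D hD huv.1 huv.2, Or.inl (ncard_le_of_indep hD fun w hw => h w ?_ ?_)⟩
    · rintro rfl; exact huv.1 hw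
    · rintro rfl; exact huv.2 hw

/-- The graph on `Fin n` in which `i < j` are adjacent when `R i j`. -/
def graphOfRel (n : ℕ) (R : ℕ → ℕ → Prop) : SimpleGraph (Fin n) where
  Adj i j := (i.val < j.val ∧ R i j) ∨ (j.val < i.val ∧ R j i)
  symm := ⟨fun _ _ h => h.symm⟩
  loopless := ⟨fun i h => by omega⟩

theorem graphOfRel_adj {n : ℕ} {R : ℕ → ℕ → Prop} {i j : Fin n} :
    (graphOfRel n R).Adj i j ↔ (i.val < j.val ∧ R i j) ∨ (j.val < i.val ∧ R j i) :=
  Iff.rfl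

theorem sum_le_ncard_edgeSet {n : ℕ} {R : ℕ → ℕ → Prop} (c : ℕ → ℕ)
    (h : ∀ j < n, ∃ A : Finset ℕ, c j ≤ A.card ∧ ∀ i ∈ A, i < j ∧ R i j) :
    ∑ j ∈ Finset.range n, c j ≤ (graphOfRel n R).edgeSet.ncard := by
  have h' : ∀ j, ∃ A : Finset ℕ, j < n → c j ≤ A.card ∧ ∀ i ∈ A, i < j ∧ R i j := by
    intro j
    by_cases hj : j < n
    · obtain ⟨A, hA⟩ := h j hj
      exact ⟨A, fun _ => hA⟩
    · exact ⟨∅, fun h => absurd h hj⟩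
  choose A hA using h'
  calc ∑ j ∈ Finset.range n, c j ≤ ∑ j ∈ Finset.range n, (A j).card :=
        Finset.sum_le_sum fun j hj => (hA j (Finset.mem_range.1 hj)).1
    _ = ((Finset.range n).sigma A).card := (Finset.card_sigma _ _).symm
    _ = (((Finset.range n).sigma A : Finset (Σ _ : ℕ, ℕ)) : Set (Σ _ : ℕ, ℕ)).ncard :=
        (Set.ncard_coe_finset _).symm
    _ ≤ (Sym2.map Fin.val '' (graphOfRel n R).edgeSet).ncard := ?_
    _ = (graphOfRel n R).edgeSet.ncard :=
        Set.ncard_image_of_injective _ (Sym2.map.injective Fin.val_injective)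
  refine Set.ncard_le_ncard_of_injOn (fun p => s(p.2, p.1)) ?_ ?_ (Set.toFinite _)
  · rintro ⟨j, i⟩ hp
    simp only [Finset.mem_coe, Finset.mem_sigma, Finset.mem_range] at hp
    have hi := (hA j hp.1).2 i hp.2
    refine ⟨s(⟨i, hi.1.trans hp.1⟩, ⟨j, hp.1⟩), ?_, rfl⟩
    exact Or.inl hi
  · rintro ⟨j, i⟩ hp ⟨j', i'⟩ hp' heq
    simp only [Finset.mem_coe, Finset.mem_sigma, Finset.mem_range] at hp hp'
    have hi := (hA j hp.1).2 i hp.2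
    have hi' := (hA j' hp'.1).2 i' hp'.2
    simp only [Sym2.eq_iff] at heq
    have h1 : j = j' := by omega
    have h2 : i = i' := by omega
    subst h1 h2
    rfl

theorem ncard_setOf_two_le {n r : ℕ} (h : r + 2 ≤ n) :
    {i : Fin n | 2 ≤ i.val ∧ i.val < r + 2}.ncard = r := by
  rw [← Set.ncard_image_of_injective _ Fin.val_injective]
  have : Fin.val '' {i : Fin n | 2 ≤ i.val ∧ i.val < r + 2} = (Finset.Ico 2 (r + 2) : Set ℕ) := by
    ext a
    simp only [Set.mem_image, Set.mem_ofPred_eq, Finset.coe_Ico, Set.mem_Ico]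
    constructor
    · rintro ⟨i, hi, rfl⟩; exact hi
    · intro ha; exact ⟨⟨a, by omega⟩, ha, rfl⟩
  rw [this, Set.ncard_coe_finset, Nat.card_Ico]
  omega

theorem two_mul_sum_range_three_add (m : ℕ) :
    2 * ∑ t ∈ Finset.range m, (3 + t) + 6 = 2 * (m + 3).choose 2 := by
  rw [two_mul_choose_two]
  induction m with
  | zero => simp
  | succ m ih =>
    rw [Finset.sum_range_succ]
    have : (m + 1) * (m + 1 + 1) = m * (m + 1) + 2 * m + 2 := by ring
    omega

/-- Vertices `0` and `1` share the neighbors `2` and `3`, those from `r + 2` onwards form a clique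
completely joined to `{0, 1, 2}`, and all remaining vertices are isolated. -/
def IsolatedRel (r i j : ℕ) : Prop :=
  (i < 2 ∧ (j = 2 ∨ j = 3 ∨ r + 2 ≤ j)) ∨ (i = 2 ∧ r + 2 ≤ j) ∨ r + 2 ≤ i

theorem crNum_gammaCR_graphOfRel_isolatedRel {n r : ℕ} (hr : 2 ≤ r) (hn : r + 2 ≤ n) :
    crNum (graphOfRel n (IsolatedRel r)) = 2 ∧ gammaCR (graphOfRel n (IsolatedRel r)) = r := by
  have hcard := ncard_setOf_two_le hn
  set S : Set (Fin n) := {i : Fin n | 2 ≤ i.val ∧ i.val < r + 2} with hS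
  have hmem : ∀ i, i ∈ S ↔ 2 ≤ i.val ∧ i.val < r + 2 := fun i => Iff.rfl
  let e (a : ℕ) (h : a < 4) : Fin n := ⟨a, by omega⟩
  have key : ∀ D : Set (Fin n),
      (∀ w, ∃ s ∈ D, s = w ∨ (graphOfRel n (IsolatedRel r)).Adj w s) → ∀ a ∈ D, ∀ b : Fin n,
      a.val < 2 → b.val < 2 → a ≠ b →
      2 ≤ crOf (graphOfRel n (IsolatedRel r)) D ∧ S.ncard ≤ D.ncard := by
    intro D hD a ha b ha2 hb2 hab
    obtain ⟨u, hu, hub⟩ := hD b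
    simp only [graphOfRel_adj, IsolatedRel, Fin.ext_iff, ne_eq] at hub hab
    refine ⟨?_, ?_⟩
    · by_cases hub' : u = b
      · subst hub'
        refine two_le_crOf (u := e 2 (by omega)) (v := e 3 (by omega)) (by simp [e])
          ⟨a, ha, u, hu, ?_⟩ ⟨a, ha, u, hu, ?_⟩ <;>
        · simp only [graphOfRel_adj, IsolatedRel, true_or, or_true, true_and, and_true,
            Fin.ext_iff, e, ne_eq]
          omega
      · refine two_le_crOf (u := a) (v := u) ?_ ⟨a, ha, u, hu, ?_⟩ ⟨a, ha, u, hu, ?_⟩ <;>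
        · simp only [graphOfRel_adj, IsolatedRel, true_or, true_and, and_true,
            Fin.ext_iff, ne_eq] at hub' ⊢
          omega
    · classical
      refine Set.ncard_le_ncard_of_injOn
        (fun i => if i.val = 2 then a else if i.val = 3 then u else i) ?_ ?_ (Set.toFinite _)
      · intro i hi
        rw [hmem] at hi
        split_ifs with h2 h3
        · exact ha
        · exact hu
        · obtain ⟨w, hw, hwi⟩ := hD i
          have : w = i := by
            simp only [graphOfRel_adj, IsolatedRel, Fin.ext_iff] at hwi ⊢
            omega
          exact this ▸ hw
      · intro i hi j hj hij
        rw [hmem] at hi hj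
        dsimp only at hij
        split_ifs at hij <;> simp only [Fin.ext_iff] at hij ⊢ <;> omega
  have hmain := crNum_eq_two_and_gammaCR_eq_of_pair (G := graphOfRel n (IsolatedRel r)) (S := S)
    (e 0 (by omega)) (e 1 (by omega)) ?_ ?_ ?_ ?_
  · rwa [hcard] at hmain
  · intro w
    by_cases hw : 2 ≤ w.val ∧ w.val < r + 2
    · exact ⟨w, hw, Or.inl rfl⟩
    · refine ⟨e 2 (by omega), ⟨le_rfl, by simp only [e]; omega⟩, Or.inr ?_⟩
      simp only [graphOfRel_adj, IsolatedRel, true_or, true_and, and_true, e]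
      omega
  · intro w hw0 hw1 s hs t ht hsw htw
    simp only [graphOfRel_adj, IsolatedRel, Fin.ext_iff, hmem, e, ne_eq] at *
    omega
  · intro D hD h0 h1
    obtain ⟨p, hp, hp3⟩ := hD (e 3 (by omega))
    obtain ⟨u, hu, hu2⟩ := hD (e 2 (by omega))
    have hne : ∀ w ∈ D, w.val ≠ 0 ∧ w.val ≠ 1 := fun w hw =>
      ⟨fun h => h0 (by rwa [show e 0 (by omega) = w from Fin.ext h.symm]),
        fun h => h1 (by rwa [show e 1 (by omega) = w from Fin.ext h.symm])⟩
    have hpn := hne p hp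
    have hun := hne u hu
    simp only [graphOfRel_adj, IsolatedRel, true_or, or_true, true_and, and_true,
      Fin.ext_iff, e] at hp3 hu2
    refine two_le_crOf (u := e 0 (by omega)) (v := e 1 (by omega)) (by simp [e])
      ⟨p, hp, u, hu, ?_⟩ ⟨p, hp, u, hu, ?_⟩ <;>
    · simp only [graphOfRel_adj, IsolatedRel, Fin.ext_iff, e, ne_eq]
      omega
  · rintro D hD (h | h)
    · have := key D hD _ h (e 1 (by omega)) (by simp [e]) (by simp [e]) (by simp [e])
      exact ⟨this.1, Or.inl this.2⟩
    · have := key D hD _ h (e 0 (by omega)) (by simp [e]) (by simp [e]) (by simp [e])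
      exact ⟨this.1, Or.inl this.2⟩

/-- Vertices `0` and `1` are nonadjacent and adjacent to all others, those from `r + 2` onwards form
a clique, and each of them has exactly one neighbor among `2, …, r + 1`, every one of which is
such a neighbor. -/
def SurjectiveRel (r i j : ℕ) : Prop :=
  (i < 2 ∧ 2 ≤ j) ∨ (2 ≤ i ∧ i < r + 2 ∧ j = i + r) ∨ (i = 2 ∧ 2 * r + 2 ≤ j) ∨ r + 2 ≤ i

theorem crNum_gammaCR_graphOfRel_surjectiveRel {n r : ℕ} (hr : 3 ≤ r) (hn : 2 * r + 2 ≤ n) :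
    crNum (graphOfRel n (SurjectiveRel r)) = 2 ∧ gammaCR (graphOfRel n (SurjectiveRel r)) = r := by
  have hcard := ncard_setOf_two_le (show r + 2 ≤ n by omega)
  set S : Set (Fin n) := {i : Fin n | 2 ≤ i.val ∧ i.val < r + 2} with hS
  have hmem : ∀ i, i ∈ S ↔ 2 ≤ i.val ∧ i.val < r + 2 := fun i => Iff.rfl
  let e (a : ℕ) (h : a < 2 * r + 2) : Fin n := ⟨a, by omega⟩
  have key : ∀ D : Set (Fin n),
      (∀ w, ∃ s ∈ D, s = w ∨ (graphOfRel n (SurjectiveRel r)).Adj w s) → ∀ a ∈ D, ∀ b : Fin n,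
      a.val < 2 → b.val < 2 → a ≠ b → 3 ≤ crOf (graphOfRel n (SurjectiveRel r)) D := by
    intro D hD a ha b ha2 hb2 hab
    obtain ⟨u, hu, hub⟩ := hD b
    simp only [graphOfRel_adj, SurjectiveRel, Fin.ext_iff, ne_eq] at hub hab
    by_cases hub' : u = b
    · subst hub'
      refine three_le_crOf (u := e 2 (by omega)) (v := e 3 (by omega)) (w := e 4 (by omega))
        (by simp [e]) (by simp [e]) (by simp [e])
        ⟨a, ha, u, hu, ?_⟩ ⟨a, ha, u, hu, ?_⟩ ⟨a, ha, u, hu, ?_⟩ <;>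
      · simp only [graphOfRel_adj, SurjectiveRel, true_and, Fin.ext_iff, e, ne_eq]
        omega
    · obtain ⟨w, hw⟩ : ∃ w : Fin n, (r + 2 ≤ u.val ∧ r + 2 ≤ w.val ∧ w.val ≠ u.val) ∨
          (u.val < r + 2 ∧ w.val = u.val + r) := by
        by_cases h1 : u.val < r + 2
        · exact ⟨⟨u.val + r, by omega⟩, Or.inr ⟨h1, rfl⟩⟩
        · by_cases h2 : u.val = r + 2
          · exact ⟨e (r + 3) (by omega), Or.inl ⟨by omega, by simp [e], by simp [e, h2]⟩⟩
          · exact ⟨e (r + 2) (by omega), Or.inl ⟨by omega, by simp [e], by simp only [e]; omega⟩⟩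
      refine three_le_crOf (u := a) (v := u) (w := w) ?_ ?_ ?_
        ⟨a, ha, u, hu, ?_⟩ ⟨a, ha, u, hu, ?_⟩ ⟨a, ha, u, hu, ?_⟩ <;>
      · simp only [graphOfRel_adj, SurjectiveRel, true_or, true_and, and_true, Fin.ext_iff,
          ne_eq] at hub' ⊢
        omega
  have hmain := crNum_eq_two_and_gammaCR_eq_of_pair (G := graphOfRel n (SurjectiveRel r)) (S := S)
    (e 0 (by omega)) (e 1 (by omega)) ?_ ?_ ?_ ?_
  · rwa [hcard] at hmain
  · intro w
    by_cases hw : 2 ≤ w.val ∧ w.val < r + 2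
    · exact ⟨w, hw, Or.inl rfl⟩
    · by_cases hw' : r + 2 ≤ w.val ∧ w.val < 2 * r + 2
      · refine ⟨e (w.val - r) (by omega), ⟨by simp only [e]; omega, by simp only [e]; omega⟩,
          Or.inr ?_⟩
        simp only [graphOfRel_adj, SurjectiveRel, e]
        omega
      · refine ⟨e 2 (by omega), ⟨le_rfl, by simp only [e]; omega⟩, Or.inr ?_⟩
        simp only [graphOfRel_adj, SurjectiveRel, true_and, e]
        omega
  · intro w hw0 hw1 s hs t ht hsw htw
    simp only [graphOfRel_adj, SurjectiveRel, Fin.ext_iff, hmem, e, ne_eq] at *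
    omega
  · intro D hD h0 h1
    obtain ⟨p, hp, hp3⟩ := hD (e 3 (by omega))
    obtain ⟨u, hu, hu2⟩ := hD (e 2 (by omega))
    have hne : ∀ w ∈ D, w.val ≠ 0 ∧ w.val ≠ 1 := fun w hw =>
      ⟨fun h => h0 (by rwa [show e 0 (by omega) = w from Fin.ext h.symm]),
        fun h => h1 (by rwa [show e 1 (by omega) = w from Fin.ext h.symm])⟩
    have hpn := hne p hp
    have hun := hne u hu
    simp only [graphOfRel_adj, SurjectiveRel, true_and, Fin.ext_iff,
      e] at hp3 hu2
    refine two_le_crOf (u := e 0 (by omega)) (v := e 1 (by omega)) (by simp [e])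
      ⟨p, hp, u, hu, ?_⟩ ⟨p, hp, u, hu, ?_⟩ <;>
    · simp only [graphOfRel_adj, SurjectiveRel, Fin.ext_iff, e, ne_eq]
      omega
  · rintro D hD (h | h)
    · have := key D hD _ h (e 1 (by omega)) (by simp [e]) (by simp [e]) (by simp [e])
      exact ⟨by omega, Or.inr this⟩
    · have := key D hD _ h (e 0 (by omega)) (by simp [e]) (by simp [e]) (by simp [e])
      exact ⟨by omega, Or.inr this⟩

/-- Vertices `0` and `1` are adjacent, vertex `0` misses only `r + 2` and vertex `1` misses only
`r + 3`, the vertices from `r + 2` onwards form a clique, and their only neighbor among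
`2, …, r + 1` is `2`. -/
def CommonRel (r i j : ℕ) : Prop :=
  (i = 0 ∧ j ≠ r + 2) ∨ (i = 1 ∧ j ≠ r + 3) ∨ (i = 2 ∧ r + 2 ≤ j) ∨ r + 2 ≤ i

theorem crNum_gammaCR_graphOfRel_commonRel {n r : ℕ} (hr : 3 ≤ r) (hn : r + 4 ≤ n) :
    crNum (graphOfRel n (CommonRel r)) = 2 ∧ gammaCR (graphOfRel n (CommonRel r)) = r := by
  have hcard := ncard_setOf_two_le (show r + 2 ≤ n by omega)
  set S : Set (Fin n) := {i : Fin n | 2 ≤ i.val ∧ i.val < r + 2} with hS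
  have hmem : ∀ i, i ∈ S ↔ 2 ≤ i.val ∧ i.val < r + 2 := fun i => Iff.rfl
  let e (a : ℕ) (h : a < r + 4) : Fin n := ⟨a, by omega⟩
  have key : ∀ D : Set (Fin n),
      (∀ w, ∃ s ∈ D, s = w ∨ (graphOfRel n (CommonRel r)).Adj w s) → ∀ a ∈ D, ∀ b c d : Fin n,
      (a.val = 0 ∧ b.val = 1 ∧ c.val = r + 2 ∧ d.val = r + 3 ∨
        a.val = 1 ∧ b.val = 0 ∧ c.val = r + 3 ∧ d.val = r + 2) →
      3 ≤ crOf (graphOfRel n (CommonRel r)) D := by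
    intro D hD a ha b c d habcd
    obtain ⟨u, hu, huc⟩ := hD c
    simp only [graphOfRel_adj, CommonRel, Fin.ext_iff] at huc
    obtain ⟨v₁, v₂, v₃, hv⟩ : ∃ v₁ v₂ v₃ : Fin n,
        (u = b ∧ v₁.val = 2 ∧ v₂.val = 3 ∧ v₃.val = 4) ∨
        (u = c ∧ v₁ = b ∧ v₂.val = 2 ∧ v₃ = d) ∨
        (u.val = 2 ∧ v₁ = a ∧ v₂ = u ∧ v₃ = b) ∨
        (r + 2 ≤ u.val ∧ u ≠ c ∧ v₁ = a ∧ v₂ = u ∧ v₃.val = 2) := by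
      by_cases h1 : u = b
      · exact ⟨e 2 (by omega), e 3 (by omega), e 4 (by omega), Or.inl ⟨h1, rfl, rfl, rfl⟩⟩
      by_cases h2 : u = c
      · exact ⟨b, e 2 (by omega), d, Or.inr (Or.inl ⟨h2, rfl, rfl, rfl⟩)⟩
      by_cases h3 : u.val = 2
      · exact ⟨a, u, b, Or.inr (Or.inr (Or.inl ⟨h3, rfl, rfl, rfl⟩))⟩
      · refine ⟨a, u, e 2 (by omega), Or.inr (Or.inr (Or.inr ⟨?_, h2, rfl, rfl, rfl⟩))⟩
        rw [Fin.ext_iff] at h1 h2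
        omega
    simp only [Fin.ext_iff, ne_eq] at hv
    refine three_le_crOf (u := v₁) (v := v₂) (w := v₃) ?_ ?_ ?_
      ⟨a, ha, u, hu, ?_⟩ ⟨a, ha, u, hu, ?_⟩ ⟨a, ha, u, hu, ?_⟩ <;>
    · simp only [graphOfRel_adj, CommonRel, Fin.ext_iff, ne_eq]
      omega
  have hmain := crNum_eq_two_and_gammaCR_eq_of_pair (G := graphOfRel n (CommonRel r)) (S := S)
    (e 0 (by omega)) (e 1 (by omega)) ?_ ?_ ?_ ?_
  · rwa [hcard] at hmain
  · intro w
    by_cases hw : 2 ≤ w.val ∧ w.val < r + 2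
    · exact ⟨w, hw, Or.inl rfl⟩
    · refine ⟨e 2 (by omega), ⟨le_rfl, by simp only [e]; omega⟩, Or.inr ?_⟩
      simp only [graphOfRel_adj, CommonRel, true_and, e]
      omega
  · intro w hw0 hw1 s hs t ht hsw htw
    simp only [graphOfRel_adj, CommonRel, Fin.ext_iff, hmem, e, ne_eq] at *
    omega
  · intro D hD h0 h1
    obtain ⟨p, hp, hp3⟩ := hD (e 3 (by omega))
    obtain ⟨u, hu, hu4⟩ := hD (e 4 (by omega))
    have hne : ∀ w ∈ D, w.val ≠ 0 ∧ w.val ≠ 1 := fun w hw =>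
      ⟨fun h => h0 (by rwa [show e 0 (by omega) = w from Fin.ext h.symm]),
        fun h => h1 (by rwa [show e 1 (by omega) = w from Fin.ext h.symm])⟩
    have hpn := hne p hp
    have hun := hne u hu
    simp only [graphOfRel_adj, CommonRel, Fin.ext_iff, e] at hp3 hu4
    refine two_le_crOf (u := e 0 (by omega)) (v := e 1 (by omega)) (by simp [e])
      ⟨p, hp, u, hu, ?_⟩ ⟨p, hp, u, hu, ?_⟩ <;>
    · simp only [graphOfRel_adj, CommonRel, true_and, Fin.ext_iff, e, ne_eq]
      omega
  · rintro D hD (h | h)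
    · have := key D hD _ h (e 1 (by omega)) (e (r + 2) (by omega)) (e (r + 3) (by omega))
        (by simp [e])
      exact ⟨by omega, Or.inr this⟩
    · have := key D hD _ h (e 0 (by omega)) (e (r + 3) (by omega)) (e (r + 2) (by omega))
        (by simp [e])
      exact ⟨by omega, Or.inr this⟩

theorem sum_add_sum_le_ncard_edgeSet {r m : ℕ} {R : ℕ → ℕ → Prop} (c d : ℕ → ℕ)
    (hc : ∀ j < r + 2, ∃ A : Finset ℕ, c j ≤ A.card ∧ ∀ i ∈ A, i < j ∧ R i j)
    (hd : ∀ t < m, ∃ A : Finset ℕ, d t ≤ A.card ∧ ∀ i ∈ A, i < r + 2 + t ∧ R i (r + 2 + t)) :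
    ∑ j ∈ Finset.range (r + 2), c j + ∑ t ∈ Finset.range m, d t ≤
      (graphOfRel (r + m + 2) R).edgeSet.ncard := by
  have h := sum_le_ncard_edgeSet (n := r + m + 2) (R := R)
    (fun j => if j < r + 2 then c j else d (j - (r + 2))) ?_
  · rw [show Finset.range (r + m + 2) = Finset.range (r + 2 + m) by congr 1; omega,
      Finset.sum_range_add] at h
    refine le_trans (le_of_eq ?_) h
    congr 1
    · exact Finset.sum_congr rfl fun j hj => (if_pos (Finset.mem_range.1 hj)).symm
    · refine Finset.sum_congr rfl fun t _ => ?_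
      rw [if_neg (by omega), Nat.add_sub_cancel_left]
  · intro j hj
    by_cases hjr : j < r + 2
    · simpa only [if_pos hjr] using hc j hjr
    · obtain ⟨t, rfl⟩ := Nat.exists_eq_add_of_le (not_lt.1 hjr)
      simpa only [if_neg hjr, Nat.add_sub_cancel_left] using hd t (by omega)

theorem le_ncard_edgeSet_isolatedRel {r m : ℕ} (hr : 2 ≤ r) :
    (m + 3).choose 2 + 1 ≤ (graphOfRel (r + m + 2) (IsolatedRel r)).edgeSet.ncard := by
  have h := sum_add_sum_le_ncard_edgeSet (r := r) (m := m) (R := IsolatedRel r)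
    (fun j => if j = 2 ∨ j = 3 then 2 else 0) (fun t => 3 + t) ?_ ?_
  · have h1 := two_mul_sum_range_three_add m
    have h2 : ∑ j ∈ ({2, 3} : Finset ℕ), (if j = 2 ∨ j = 3 then 2 else 0) ≤
        ∑ j ∈ Finset.range (r + 2), (if j = 2 ∨ j = 3 then 2 else 0) := by
      refine Finset.sum_le_sum_of_subset fun j hj => ?_
      simp only [Finset.mem_insert, Finset.mem_singleton] at hj
      exact Finset.mem_range.2 (by omega)
    simp at h2
    omega
  · intro j hj
    split_ifs with h
    · refine ⟨{0, 1}, by simp, fun i hi => ?_⟩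
      simp only [Finset.mem_insert, Finset.mem_singleton] at hi
      unfold IsolatedRel
      omega
    · exact ⟨∅, by simp, by simp⟩
  · intro t ht
    refine ⟨Finset.range 3 ∪ Finset.Ico (r + 2) (r + 2 + t), ?_, fun i hi => ?_⟩
    · rw [Finset.card_union_of_disjoint]
      · simp
      · rw [Finset.disjoint_left]
        simp only [Finset.mem_range, Finset.mem_Ico]
        omega
    · simp only [Finset.mem_union, Finset.mem_range, Finset.mem_Ico] at hi
      unfold IsolatedRel
      omega

theorem le_ncard_edgeSet_surjectiveRel {r m : ℕ} (hr : 2 ≤ r) :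
    2 * (r - 2) + (m + 3).choose 2 + 1 ≤
      (graphOfRel (r + m + 2) (SurjectiveRel r)).edgeSet.ncard := by
  have h := sum_add_sum_le_ncard_edgeSet (r := r) (m := m) (R := SurjectiveRel r)
    (fun j => if 2 ≤ j then 2 else 0) (fun t => 3 + t) ?_ ?_
  · have h1 := two_mul_sum_range_three_add m
    simp [Finset.sum_range_succ'] at h
    omega
  · intro j hj
    split_ifs with h
    · refine ⟨{0, 1}, by simp, fun i hi => ?_⟩
      simp only [Finset.mem_insert, Finset.mem_singleton] at hi
      unfold SurjectiveRel
      omega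
    · exact ⟨∅, by simp, by simp⟩
  · intro t ht
    refine ⟨{0, 1, if t < r then 2 + t else 2} ∪ Finset.Ico (r + 2) (r + 2 + t), ?_,
      fun i hi => ?_⟩
    · rw [Finset.card_union_of_disjoint, Finset.card_eq_three.2
        ⟨0, 1, _, by omega, by split_ifs <;> omega, by split_ifs <;> omega, rfl⟩]
      · simp
      · rw [Finset.disjoint_left]
        simp only [Finset.mem_insert, Finset.mem_singleton, Finset.mem_Ico]
        intro a ha
        split_ifs at ha <;> omega
    · simp only [Finset.mem_union, Finset.mem_insert, Finset.mem_singleton, Finset.mem_Ico] at hi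
      unfold SurjectiveRel
      split_ifs at hi <;> omega

theorem le_ncard_edgeSet_commonRel {r m : ℕ} (hr : 2 ≤ r) (hm : 2 ≤ m) :
    2 * (r - 2) + (m + 3).choose 2 ≤ (graphOfRel (r + m + 2) (CommonRel r)).edgeSet.ncard := by
  have h := sum_add_sum_le_ncard_edgeSet (r := r) (m := m) (R := CommonRel r)
    (fun j => if 2 ≤ j then 2 else j) (fun t => if t < 2 then 2 + t else 3 + t) ?_ ?_
  · have h1 := two_mul_sum_range_three_add m
    have h2 : ∑ t ∈ Finset.range m, (3 + t) =
        ∑ t ∈ Finset.range m, (if t < 2 then 2 + t else 3 + t) + 2 := by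
      obtain ⟨k, rfl⟩ := Nat.exists_eq_add_of_le' hm
      simp [Finset.sum_range_succ']
    rw [Finset.sum_range_succ', Finset.sum_range_succ'] at h
    simp at h
    simp only [Nat.lt_succ_iff] at h2
    omega
  · intro j hj
    split_ifs with h
    · refine ⟨{0, 1}, by simp, fun i hi => ?_⟩
      simp only [Finset.mem_insert, Finset.mem_singleton] at hi
      unfold CommonRel
      omega
    · refine ⟨Finset.range j, by simp, fun i hi => ?_⟩
      rw [Finset.mem_range] at hi
      unfold CommonRel
      omega
  · intro t ht
    split_ifs with h
    · refine ⟨{1 - t, 2} ∪ Finset.Ico (r + 2) (r + 2 + t), ?_, fun i hi => ?_⟩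
      · rw [Finset.card_union_of_disjoint, Finset.card_pair (by omega)]
        · simp
        · rw [Finset.disjoint_left]
          simp only [Finset.mem_insert, Finset.mem_singleton, Finset.mem_Ico]
          omega
      · simp only [Finset.mem_union, Finset.mem_insert, Finset.mem_singleton, Finset.mem_Ico] at hi
        unfold CommonRel
        omega
    · refine ⟨Finset.range 3 ∪ Finset.Ico (r + 2) (r + 2 + t), ?_, fun i hi => ?_⟩
      · rw [Finset.card_union_of_disjoint]
        · simp
        · rw [Finset.disjoint_left]
          simp only [Finset.mem_range, Finset.mem_Ico]
          omega
      · simp only [Finset.mem_union, Finset.mem_range, Finset.mem_Ico] at hi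
        unfold CommonRel
        omega

end Extremal

theorem isMaxEdges_of_le {n r M : ℕ} {G : SimpleGraph (Fin n)}
    (hle : ∀ (V : Type) [Fintype V] (G : SimpleGraph V), Fintype.card V = n →
      crNum G = 2 → gammaCR G = r → G.edgeSet.ncard ≤ M)
    (hG : crNum G = 2 ∧ gammaCR G = r) (hM : M ≤ G.edgeSet.ncard) : IsMaxEdges n r M :=
  ⟨hle, G, hG.1, hG.2, le_antisymm (hle _ G (Fintype.card_fin n) hG.1 hG.2) hM⟩

theorem M_n_two_r (n r : ℕ) (hn : 5 ≤ n) (hr : 2 ≤ r) :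
    (r = 2 → IsMaxEdges n r ((n - 1).choose 2 + 1)) ∧
    (3 ≤ r → r ≤ n - 4 → r ≤ n - r - 2 →
        IsMaxEdges n r (2 * (r - 2) + (n - r + 1).choose 2 + 1)) ∧
    (3 ≤ r → r ≤ n - 4 → n - r - 2 < r →
        IsMaxEdges n r (2 * (r - 2) + (n - r + 1).choose 2)) ∧
    (r = n - 3 → IsMaxEdges n r 7) ∧
    (r = n - 2 → IsMaxEdges n r 4) := by
  refine ⟨?_, ?_, ?_, ?_, ?_⟩
  · rintro rfl
    obtain ⟨m, rfl⟩ : ∃ m, n = 2 + m + 2 := ⟨n - 4, by omega⟩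
    rw [show 2 + m + 2 - 1 = m + 3 by omega]
    refine isMaxEdges_of_le (fun V _ G hV hcr hg => ?_)
      (crNum_gammaCR_graphOfRel_isolatedRel le_rfl (by omega)) (le_ncard_edgeSet_isolatedRel le_rfl)
    have := ncard_edgeSet_le hcr (m := m) (by omega) (by omega)
    omega
  · intro h3 h4 hle
    obtain ⟨m, rfl⟩ : ∃ m, n = r + m + 2 := ⟨n - r - 2, by omega⟩
    rw [show r + m + 2 - r + 1 = m + 3 by omega]
    refine isMaxEdges_of_le (fun V _ G hV hcr hg => ?_)
      (crNum_gammaCR_graphOfRel_surjectiveRel h3 (by omega)) (le_ncard_edgeSet_surjectiveRel hr)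
    subst hg
    exact ncard_edgeSet_le hcr hr hV
  · intro h3 h4 hlt
    obtain ⟨m, rfl⟩ : ∃ m, n = r + m + 2 := ⟨n - r - 2, by omega⟩
    rw [show r + m + 2 - r + 1 = m + 3 by omega]
    refine isMaxEdges_of_le (fun V _ G hV hcr hg => ?_)
      (crNum_gammaCR_graphOfRel_commonRel h3 (by omega))
      (le_ncard_edgeSet_commonRel hr (by omega))
    subst hg
    exact ncard_edgeSet_le_of_lt hcr h3 hV (by omega)
  · intro h
    obtain rfl : n = r + 1 + 2 := by omega
    refine isMaxEdges_of_le (fun V _ G hV hcr hg => ?_)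
      (crNum_gammaCR_graphOfRel_isolatedRel hr (by omega)) (le_ncard_edgeSet_isolatedRel (m := 1) hr)
    subst hg
    exact ncard_edgeSet_le_seven hcr hr hV
  · intro h
    obtain rfl : n = r + 0 + 2 := by omega
    refine isMaxEdges_of_le (fun V _ G hV hcr hg => ?_)
      (crNum_gammaCR_graphOfRel_isolatedRel hr (by omega)) (le_ncard_edgeSet_isolatedRel (m := 0) hr)
    subst hg
    exact ncard_edgeSet_le_four hcr hr hV
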